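/- arXiv:2501.15034 — 5 statements merged into one kernel-verified Lean document; each statement's English description precedes it below -/
import Mathlib

section
/- Policy Gradient Theorem (Lemma 1). For a finite MDP with discount γ ∈ (0,1) and a parametrized policy θ ↦ π_θ such that θ ↦ π_θ(a|s) is differentiable for every (s,a), the map θ ↦ μ_{π_θ}(s,a) is differentiable for every (s,a), and for every function f : S×A → ℝ one has ∑_{s,a} f(s,a) ∇_θ μ_{π_θ}(s,a) = ∑_{s,a} d_{π_θ}(s) Q^{π_θ}(f)(s,a) ∇_θ π_θ(a|s). -/
open scoped BigOperators

noncomputable section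

/-- Policy-induced state transition matrix: `Pmat P π s' s = ∑ a, P s a s' * π s a`. -/
def Pmat {S A : Type*} [Fintype A] (P : S → A → S → ℝ) (π : S → A → ℝ) :
    Matrix S S ℝ := fun s' s => ∑ a, P s a s' * π s a

/-- Discounted state distribution `d_π(s) = (1-γ) ∑_t γ^t (P_π^t d_0)(s)`. -/
def dpi {S A : Type*} [Fintype S] [DecidableEq S] [Fintype A]
    (P : S → A → S → ℝ) (d0 : S → ℝ) (γ : ℝ) (π : S → A → ℝ) (s : S) : ℝ :=
  (1 - γ) * ∑' t : ℕ, γ ^ t * ((Pmat P π ^ t).mulVec d0 s)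

/-- Discounted state-action distribution `μ_π(s,a) = d_π(s) π(a|s)`. -/
def mupi {S A : Type*} [Fintype S] [DecidableEq S] [Fintype A]
    (P : S → A → S → ℝ) (d0 : S → ℝ) (γ : ℝ) (π : S → A → ℝ) (s : S) (a : A) : ℝ :=
  dpi P d0 γ π s * π s a


lemma pg_pow_bound {S : Type*} [Fintype S] [DecidableEq S] (M : Matrix S S ℝ)
    (hnn : ∀ i j, 0 ≤ M i j) (hs : ∀ j, ∑ i, M i j = 1) (d0 : S → ℝ)
    (hd0nn : ∀ s, 0 ≤ d0 s) (hd0sum : ∑ s, d0 s = 1) (t : ℕ) :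
    (∀ s, 0 ≤ (M ^ t).mulVec d0 s) ∧ ∑ s, (M ^ t).mulVec d0 s = 1 := by
  induction t with
  | zero => simpa using ⟨hd0nn, hd0sum⟩
  | succ t ih =>
    rw [pow_succ', ← Matrix.mulVec_mulVec]
    generalize (M ^ t).mulVec d0 = w at ih
    refine ⟨fun s => Finset.sum_nonneg fun j _ => mul_nonneg (hnn _ _) (ih.1 j), ?_⟩
    simp only [Matrix.mulVec, dotProduct]
    rw [Finset.sum_comm]
    simp only [← Finset.sum_mul, hs, one_mul, ih.2]

lemma pg_summable {S : Type*} [Fintype S] [DecidableEq S] (M : Matrix S S ℝ)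
    (hnn : ∀ i j, 0 ≤ M i j) (hs : ∀ j, ∑ i, M i j = 1) (d0 : S → ℝ)
    (hd0nn : ∀ s, 0 ≤ d0 s) (hd0sum : ∑ s, d0 s = 1)
    (γ : ℝ) (hγ0 : 0 < γ) (hγ1 : γ < 1) (s : S) :
    Summable fun t : ℕ => γ ^ t * ((M ^ t).mulVec d0 s) := by
  refine Summable.of_nonneg_of_le (fun t => ?_) (fun t => ?_)
    (summable_geometric_of_lt_one hγ0.le hγ1)
  · exact mul_nonneg (by positivity) ((pg_pow_bound M hnn hs d0 hd0nn hd0sum t).1 s)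
  · have h := pg_pow_bound M hnn hs d0 hd0nn hd0sum t
    have h1 : (M ^ t).mulVec d0 s ≤ 1 := by
      rw [← h.2]
      exact Finset.single_le_sum (f := (M ^ t).mulVec d0) (fun i _ => h.1 i) (Finset.mem_univ s)
    exact mul_le_of_le_one_right (by positivity) h1

/-- The fixed-point (flow) equation. -/
lemma pg_flow {S : Type*} [Fintype S] [DecidableEq S] (M : Matrix S S ℝ)
    (hnn : ∀ i j, 0 ≤ M i j) (hs : ∀ j, ∑ i, M i j = 1) (d0 : S → ℝ)
    (hd0nn : ∀ s, 0 ≤ d0 s) (hd0sum : ∑ s, d0 s = 1)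
    (γ : ℝ) (hγ0 : 0 < γ) (hγ1 : γ < 1) (s : S) :
    ∑' t : ℕ, γ ^ t * ((M ^ t).mulVec d0 s) =
      d0 s + γ * ∑ j, M s j * ∑' t : ℕ, γ ^ t * ((M ^ t).mulVec d0 j) := by
  have hsum := pg_summable M hnn hs d0 hd0nn hd0sum γ hγ0 hγ1
  rw [(hsum s).tsum_eq_zero_add]
  simp only [pow_zero, Matrix.one_mulVec, one_mul]
  congr 1
  simp only [← tsum_mul_left]
  rw [← Summable.tsum_finsetSum (fun j _ => (hsum j).mul_left _), ← tsum_mul_left]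
  refine tsum_congr fun t => ?_
  rw [pow_succ' M, ← Matrix.mulVec_mulVec]
  simp only [Matrix.mulVec, dotProduct]
  rw [Finset.mul_sum, Finset.mul_sum]
  refine Finset.sum_congr rfl fun j _ => ?_
  ring

lemma pg_inj {S : Type*} [Fintype S] [DecidableEq S] (M : Matrix S S ℝ)
    (hnn : ∀ i j, 0 ≤ M i j) (hs : ∀ j, ∑ i, M i j = 1)
    (γ : ℝ) (hγ0 : 0 < γ) (hγ1 : γ < 1) : (1 - γ • M).det ≠ 0 := by
  intro h
  obtain ⟨v, hv0, hv⟩ := Matrix.exists_mulVec_eq_zero_iff.mpr h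
  apply hv0
  rw [Matrix.sub_mulVec, Matrix.one_mulVec, Matrix.smul_mulVec, sub_eq_zero] at hv
  have h1 : ∑ i, |v i| ≤ γ * ∑ i, |v i| := by
    calc ∑ i, |v i| ≤ ∑ i, γ * ∑ j, M i j * |v j| := by
          refine Finset.sum_le_sum fun i _ => ?_
          have := congrFun hv i
          simp only [Pi.smul_apply, smul_eq_mul, Matrix.mulVec, dotProduct] at this
          rw [this, abs_mul, abs_of_pos hγ0]
          refine mul_le_mul_of_nonneg_left ?_ hγ0.le
          refine (Finset.abs_sum_le_sum_abs _ _).trans_eq ?_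
          refine Finset.sum_congr rfl fun j _ => ?_
          rw [abs_mul, abs_of_nonneg (hnn i j)]
      _ = γ * ∑ i, |v i| := by
          rw [← Finset.mul_sum, Finset.sum_comm]
          simp only [← Finset.sum_mul, hs, one_mul]
  have h0 : 0 ≤ ∑ i, |v i| := Finset.sum_nonneg fun i _ => abs_nonneg _
  have h2 : ∑ i, |v i| = 0 := by nlinarith
  rw [Finset.sum_eq_zero_iff_of_nonneg (fun i _ => abs_nonneg _)] at h2
  funext i
  simpa using h2 i (Finset.mem_univ i)

lemma pg_cramer {S : Type*} [Fintype S] [DecidableEq S] (T : Matrix S S ℝ)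
    (hT : T.det ≠ 0) (b x : S → ℝ) (hx : T.mulVec x = b) (s : S) :
    x s = (T.updateCol s b).det / T.det := by
  have h : T.mulVec (T.det • x - T.cramer b) = 0 := by
    rw [Matrix.mulVec_sub, Matrix.mulVec_smul, Matrix.mulVec_cramer, hx, sub_self]
  have h2 := congrFun (Matrix.eq_zero_of_mulVec_eq_zero hT h) s
  simp only [Pi.sub_apply, Pi.smul_apply, smul_eq_mul, Pi.zero_apply, Matrix.cramer_apply] at h2
  rw [eq_div_iff hT]
  linarith

lemma pg_det_diff {S E : Type*} [Fintype S] [DecidableEq S] [NormedAddCommGroup E]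
    [NormedSpace ℝ E] (T : E → Matrix S S ℝ) (θ : E)
    (h : ∀ i j, DifferentiableAt ℝ (fun x => T x i j) θ) :
    DifferentiableAt ℝ (fun x => (T x).det) θ := by
  simp only [Matrix.det_apply']
  refine DifferentiableAt.fun_sum fun σ _ => ?_
  refine DifferentiableAt.const_mul ?_ _
  exact (HasFDerivAt.finsetProd fun i _ => (h (σ i) i).hasFDerivAt).differentiableAt

/-- Policy Gradient Theorem: for a finite MDP and a differentiable parametrized policy,
`θ ↦ μ_{π_θ}(s,a)` is differentiable and
`∑_{s,a} f(s,a) ∇_θ μ_{π_θ}(s,a) = ∑_{s,a} d_{π_θ}(s) Q^{π_θ}(f)(s,a) ∇_θ π_θ(a|s)`,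
where `Q^{π_θ}(f)` is the (unique) solution of the Bellman equation for the reward `f`. -/
theorem policy_gradient_theorem
    {S A : Type*} [Fintype S] [DecidableEq S] [Fintype A] {n : ℕ}
    (P : S → A → S → ℝ) (hPnn : ∀ s a s', 0 ≤ P s a s')
    (hPsum : ∀ s a, ∑ s', P s a s' = 1)
    (d0 : S → ℝ) (hd0nn : ∀ s, 0 ≤ d0 s) (hd0sum : ∑ s, d0 s = 1)
    (γ : ℝ) (hγ0 : 0 < γ) (hγ1 : γ < 1)
    (π : EuclideanSpace ℝ (Fin n) → S → A → ℝ)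
    (hπnn : ∀ θ s a, 0 ≤ π θ s a) (hπsum : ∀ θ s, ∑ a, π θ s a = 1)
    (hπdiff : ∀ s a, Differentiable ℝ fun θ => π θ s a)
    (f : S → A → ℝ)
    (Q : EuclideanSpace ℝ (Fin n) → S → A → ℝ)
    (hQ : ∀ θ s a, Q θ s a =
      f s a + γ * ∑ s', P s a s' * ∑ a', π θ s' a' * Q θ s' a')
    (θ : EuclideanSpace ℝ (Fin n)) :
    (∀ s a, DifferentiableAt ℝ (fun θ' => mupi P d0 γ (π θ') s a) θ) ∧
    ∑ s, ∑ a, f s a • fderiv ℝ (fun θ' => mupi P d0 γ (π θ') s a) θ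
      = ∑ s, ∑ a, (dpi P d0 γ (π θ) s * Q θ s a) •
          fderiv ℝ (fun θ' => π θ' s a) θ := by
  have hMnn : ∀ θ i j, 0 ≤ Pmat P (π θ) i j := fun θ i j =>
    Finset.sum_nonneg fun a _ => mul_nonneg (hPnn _ _ _) (hπnn _ _ _)
  have hMs : ∀ θ j, ∑ i, Pmat P (π θ) i j = 1 := fun θ j => by
    simp only [Pmat]
    rw [Finset.sum_comm]
    simp only [← Finset.sum_mul, hPsum, one_mul, hπsum]
  have hflow : ∀ θ s, dpi P d0 γ (π θ) s =
      (1 - γ) * d0 s + γ * ∑ j, Pmat P (π θ) s j * dpi P d0 γ (π θ) j := fun θ s => by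
    have h := pg_flow _ (hMnn θ) (hMs θ) d0 hd0nn hd0sum γ hγ0 hγ1 s
    simp only [dpi]
    rw [h, mul_add, mul_left_comm (1 - γ) γ, Finset.mul_sum (a := 1 - γ)]
    simp only [mul_left_comm (1 - γ)]
  have hMdiff : ∀ i j, DifferentiableAt ℝ (fun θ' => Pmat P (π θ') i j) θ := fun i j => by
    simp only [Pmat]
    exact DifferentiableAt.fun_sum fun a _ => (hπdiff j a θ).const_mul _
  have hTdiff : ∀ i j,
      DifferentiableAt ℝ (fun θ' => (1 - γ • Pmat P (π θ') : Matrix S S ℝ) i j) θ := fun i j => by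
    simp only [Matrix.sub_apply, Matrix.smul_apply, smul_eq_mul]
    exact ((hMdiff i j).const_mul γ).const_sub _
  have hdet := fun θ => pg_inj _ (hMnn θ) (hMs θ) γ hγ0 hγ1
  have hddiff : ∀ s, DifferentiableAt ℝ (fun θ' => dpi P d0 γ (π θ') s) θ := fun s => by
    have he : (fun θ' => dpi P d0 γ (π θ') s) = fun θ' =>
        ((1 - γ • Pmat P (π θ') : Matrix S S ℝ).updateCol s (fun i => (1 - γ) * d0 i)).det /
          (1 - γ • Pmat P (π θ')).det := by
      funext θ'
      refine pg_cramer _ (hdet θ') _ (fun i => dpi P d0 γ (π θ') i) ?_ s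
      rw [Matrix.sub_mulVec, Matrix.one_mulVec, Matrix.smul_mulVec]
      funext i
      have := hflow θ' i
      simp only [Pi.sub_apply, Pi.smul_apply, smul_eq_mul, Matrix.mulVec, dotProduct]
      linarith
    rw [he]
    simp only [div_eq_mul_inv]
    refine DifferentiableAt.fun_mul (pg_det_diff _ θ fun i j => ?_)
      (DifferentiableAt.fun_inv (pg_det_diff (fun θ' => 1 - γ • Pmat P (π θ')) θ hTdiff) (hdet θ))
    simp only [Matrix.updateCol_apply]
    split_ifs
    · exact differentiableAt_const _
    · exact hTdiff i j
  have hmudiff : ∀ s a, DifferentiableAt ℝ (fun θ' => mupi P d0 γ (π θ') s a) θ :=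
    fun s a => (hddiff s).fun_mul (hπdiff s a θ)
  refine ⟨hmudiff, ?_⟩
  have hDmu : ∀ s a, fderiv ℝ (fun θ' => mupi P d0 γ (π θ') s a) θ =
      dpi P d0 γ (π θ) s • fderiv ℝ (fun θ' => π θ' s a) θ +
        π θ s a • fderiv ℝ (fun θ' => dpi P d0 γ (π θ') s) θ := fun s a => by
    simp only [mupi]
    exact fderiv_fun_mul (hddiff s) (hπdiff s a θ)
  have hDd : ∀ s', fderiv ℝ (fun θ' => dpi P d0 γ (π θ') s') θ =
      γ • ∑ s, ∑ a, P s a s' • fderiv ℝ (fun θ' => mupi P d0 γ (π θ') s a) θ := fun s' => by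
    have he : (fun θ' => dpi P d0 γ (π θ') s') = fun θ' =>
        (1 - γ) * d0 s' + γ * ∑ s, ∑ a, P s a s' * mupi P d0 γ (π θ') s a := by
      funext θ'
      rw [hflow θ' s']
      simp only [Pmat, mupi, Finset.sum_mul]
      congr 2
      refine Finset.sum_congr rfl fun s _ => Finset.sum_congr rfl fun a _ => ?_
      ring
    rw [he]
    refine HasFDerivAt.fderiv ?_
    refine HasFDerivAt.const_add _ (HasFDerivAt.const_mul ?_ _)
    exact HasFDerivAt.fun_sum fun s _ => HasFDerivAt.fun_sum fun a _ =>
      (hmudiff s a).hasFDerivAt.const_mul _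
  ext v
  have hDmu' := fun s a => congrArg (fun L => L v) (hDmu s a)
  have hDd' := fun s => congrArg (fun L => L v) (hDd s)
  generalize hm : (fun s a => fderiv ℝ (fun θ' => mupi P d0 γ (π θ') s a) θ v) = m
  generalize hq : (fun s a => fderiv ℝ (fun θ' => π θ' s a) θ v) = q
  generalize hd : (fun s => fderiv ℝ (fun θ' => dpi P d0 γ (π θ') s) θ v) = d
  have hm1 := fun s a => congrFun (congrFun hm s) a
  have hq1 := fun s a => congrFun (congrFun hq s) a
  have hd1 := fun s => congrFun hd s
  simp only [_root_.sum_apply, _root_.smul_apply,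
    _root_.add_apply, smul_eq_mul] at hDmu' hDd' hm1 hq1 hd1 ⊢
  simp only [hm1, hq1, hd1] at hDmu' hDd' ⊢
  have hkey : ∑ s, ∑ a, m s a * (γ * ∑ s', P s a s' * ∑ a', π θ s' a' * Q θ s' a') =
      ∑ s, ∑ a, Q θ s a * (π θ s a * d s) := by
    calc _ = ∑ s, ∑ a, ∑ s', γ * (P s a s' * m s a) * ∑ a', π θ s' a' * Q θ s' a' := by
          refine Finset.sum_congr rfl fun s _ => Finset.sum_congr rfl fun a _ => ?_
          rw [Finset.mul_sum, Finset.mul_sum]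
          refine Finset.sum_congr rfl fun s' _ => ?_
          ring
      _ = ∑ s', ∑ s, ∑ a, γ * (P s a s' * m s a) * ∑ a', π θ s' a' * Q θ s' a' := by
          rw [Finset.sum_comm (s := Finset.univ (α := S)) (t := Finset.univ (α := S))]
          refine Finset.sum_congr rfl fun s _ => ?_
          rw [Finset.sum_comm]
      _ = ∑ s', d s' * ∑ a', π θ s' a' * Q θ s' a' := by
          refine Finset.sum_congr rfl fun s' _ => ?_
          simp only [hDd' s', Finset.mul_sum (a := γ), Finset.sum_mul]
      _ = _ := by
          refine Finset.sum_congr rfl fun s' _ => ?_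
          rw [Finset.mul_sum]
          refine Finset.sum_congr rfl fun a' _ => ?_
          ring
  have hf : ∀ s a, f s a * m s a = Q θ s a * m s a -
      m s a * (γ * ∑ s', P s a s' * ∑ a', π θ s' a' * Q θ s' a') := fun s a => by
    have := hQ θ s a
    rw [eq_sub_iff_add_eq]
    linear_combination (- m s a) * this
  simp only [hf, Finset.sum_sub_distrib]
  rw [hkey]
  simp only [← Finset.sum_sub_distrib]
  refine Finset.sum_congr rfl fun s _ => Finset.sum_congr rfl fun a _ => ?_
  rw [hDmu' s a]
  ring
end
end

section
/- Gradient of the KL-regularized objective. Let θ ↦ π_θ be a differentiable parametrized policy with π_θ(a|s) > 0 for all (s,a) and all θ, let r : S×A → ℝ, λ ≥ 0, and fix a reference parameter θ̃ with reference policy π̃ = π_{θ̃}. Define V(θ) = ∑_{s,a} μ_{π_θ}(s,a) r(s,a) and D(θ, θ̃) = ∑_{s,a} μ_{π_θ}(s,a) log(π_θ(a|s)/π̃(a|s)). Then θ ↦ V(θ) − λ D(θ, θ̃) is differentiable and its gradient equals ∑_{s,a} d_{π_θ}(s) π_θ(a|s) (A^{π_θ}(s,a) − λ 𝐀^{π_θ}_{π̃}(s,a))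 ∇_θ log π_θ(a|s), where A^{π_θ} is the advantage of the reward r under π_θ and 𝐀^{π_θ}_{π̃} is the advantage of the pseudo-reward h(s,a) = log π_θ(a|s) − log π̃(a|s) under π_θ. -/
open scoped BigOperators

noncomputable section

/-- Column-stochastic iterates stay nonnegative with total mass one. -/
theorem aux_iter {S A : Type*} [Fintype S] [DecidableEq S] [Fintype A]
    (P : S → A → S → ℝ) (hPnn : ∀ s a s', 0 ≤ P s a s')
    (hPsum : ∀ s a, ∑ s', P s a s' = 1)
    (d0 : S → ℝ) (hd0nn : ∀ s, 0 ≤ d0 s) (hd0sum : ∑ s, d0 s = 1)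
    (π : S → A → ℝ) (hpos : ∀ s a, 0 < π s a) (hsum : ∀ s, ∑ a, π s a = 1) (t : ℕ) :
    (∀ s, 0 ≤ (Pmat P π ^ t).mulVec d0 s) ∧ ∑ s, (Pmat P π ^ t).mulVec d0 s = 1 := by
  induction t with
  | zero => simpa using ⟨hd0nn, hd0sum⟩
  | succ t ih =>
    obtain ⟨h1, h2⟩ := ih
    rw [pow_succ', ← Matrix.mulVec_mulVec]
    set w := (Pmat P π ^ t).mulVec d0 with hw
    refine ⟨fun s => ?_, ?_⟩
    · exact Finset.sum_nonneg fun s' _ => mul_nonneg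
        (Finset.sum_nonneg fun a _ => mul_nonneg (hPnn _ _ _) (hpos _ _).le) (h1 _)
    · simp only [Matrix.mulVec, dotProduct]
      rw [Finset.sum_comm, ← h2]
      refine Finset.sum_congr rfl fun s _ => ?_
      rw [← Finset.sum_mul]
      have : ∑ i, Pmat P π i s = 1 := by
        simp only [Pmat]
        rw [Finset.sum_comm]
        simp_rw [← Finset.sum_mul, hPsum, one_mul, hsum]
      rw [this, one_mul]

theorem aux_bound {S A : Type*} [Fintype S] [DecidableEq S] [Fintype A]
    (P : S → A → S → ℝ) (hPnn : ∀ s a s', 0 ≤ P s a s')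
    (hPsum : ∀ s a, ∑ s', P s a s' = 1)
    (d0 : S → ℝ) (hd0nn : ∀ s, 0 ≤ d0 s) (hd0sum : ∑ s, d0 s = 1)
    (γ : ℝ) (hγ0 : 0 < γ)
    (π : S → A → ℝ) (hpos : ∀ s a, 0 < π s a) (hsum : ∀ s, ∑ a, π s a = 1) (t : ℕ) (s : S) :
    ‖γ ^ t * (Pmat P π ^ t).mulVec d0 s‖ ≤ γ ^ t := by
  obtain ⟨h1, h2⟩ := aux_iter P hPnn hPsum d0 hd0nn hd0sum π hpos hsum t
  have h3 : (Pmat P π ^ t).mulVec d0 s ≤ 1 := by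
    rw [← h2]
    exact Finset.single_le_sum (fun i _ => h1 i) (Finset.mem_univ s)
  have hg : 0 ≤ γ ^ t := by positivity
  rw [Real.norm_of_nonneg (mul_nonneg hg (h1 s))]
  exact mul_le_of_le_one_right hg h3

/-- The flow equation for the discounted state distribution. -/
theorem aux_flow {S A : Type*} [Fintype S] [DecidableEq S] [Fintype A]
    (P : S → A → S → ℝ) (hPnn : ∀ s a s', 0 ≤ P s a s')
    (hPsum : ∀ s a, ∑ s', P s a s' = 1)
    (d0 : S → ℝ) (hd0nn : ∀ s, 0 ≤ d0 s) (hd0sum : ∑ s, d0 s = 1)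
    (γ : ℝ) (hγ0 : 0 < γ) (hγ1 : γ < 1)
    (π : S → A → ℝ) (hpos : ∀ s a, 0 < π s a) (hsum : ∀ s, ∑ a, π s a = 1) (s : S) :
    dpi P d0 γ π s = (1 - γ) * d0 s + γ * ∑ s', Pmat P π s s' * dpi P d0 γ π s' := by
  have hS : ∀ s, Summable fun t : ℕ => γ ^ t * (Pmat P π ^ t).mulVec d0 s := fun s =>
    Summable.of_norm_bounded (summable_geometric_of_lt_one hγ0.le hγ1)
      (fun t => aux_bound P hPnn hPsum d0 hd0nn hd0sum γ hγ0 π hpos hsum t s)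
  have h1 : ∑' t : ℕ, γ ^ t * (Pmat P π ^ t).mulVec d0 s
      = d0 s + γ * ∑ s', Pmat P π s s' * ∑' t : ℕ, γ ^ t * (Pmat P π ^ t).mulVec d0 s' := by
    rw [(hS s).tsum_eq_zero_add]
    congr 1
    · simp
    · simp_rw [← tsum_mul_left]
      rw [← Summable.tsum_finsetSum (fun i _ => (hS i).mul_left _), ← tsum_mul_left]
      refine tsum_congr fun t => ?_
      rw [pow_succ' (Pmat P π), ← Matrix.mulVec_mulVec, Matrix.mulVec, dotProduct, pow_succ',
        Finset.mul_sum, Finset.mul_sum]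
      refine Finset.sum_congr rfl fun i _ => ?_
      ring
  unfold dpi
  rw [h1, mul_add, Finset.mul_sum, Finset.mul_sum, Finset.mul_sum]
  congr 1
  refine Finset.sum_congr rfl fun i _ => ?_
  ring

/-- Performance difference identity. -/
theorem aux_pdl {S A : Type*} [Fintype S] [DecidableEq S] [Fintype A]
    (P : S → A → S → ℝ) (hPnn : ∀ s a s', 0 ≤ P s a s')
    (hPsum : ∀ s a, ∑ s', P s a s' = 1)
    (d0 : S → ℝ) (hd0nn : ∀ s, 0 ≤ d0 s) (hd0sum : ∑ s, d0 s = 1)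
    (γ : ℝ) (hγ0 : 0 < γ) (hγ1 : γ < 1)
    (π : S → A → ℝ) (hpos : ∀ s a, 0 < π s a) (hsum : ∀ s, ∑ a, π s a = 1)
    (f f' Q : S → A → ℝ) (v : S → ℝ) (hQ : ∀ s a, Q s a = f s a + γ * ∑ s', P s a s' * v s') :
    ∑ s, ∑ a, mupi P d0 γ π s a * f' s a = (1 - γ) * ∑ s, d0 s * v s
      + ∑ s, dpi P d0 γ π s * ∑ a, π s a * (Q s a - v s + (f' s a - f s a)) := by
  have hfl := aux_flow P hPnn hPsum d0 hd0nn hd0sum γ hγ0 hγ1 π hpos hsum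
  set d := dpi P d0 γ π with hd
  have e1 : (1 - γ) * ∑ s, d0 s * v s
      = ∑ s, d s * v s - γ * ∑ s, d s * ∑ s', Pmat P π s' s * v s' := by
    have : ∑ s, d s * v s = ∑ s, ((1 - γ) * d0 s + γ * ∑ s', Pmat P π s s' * d s') * v s :=
      Finset.sum_congr rfl fun s _ => by rw [← hfl s]
    rw [this]
    simp_rw [add_mul, Finset.sum_add_distrib]
    have h2 : ∑ s, (γ * ∑ s', Pmat P π s s' * d s') * v s
        = γ * ∑ s, d s * ∑ s', Pmat P π s' s * v s' := by
      simp_rw [Finset.mul_sum, Finset.sum_mul]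
      rw [Finset.sum_comm]
      refine Finset.sum_congr rfl fun i _ => Finset.sum_congr rfl fun j _ => ?_
      ring
    rw [h2, Finset.mul_sum]
    simp_rw [← mul_assoc]
    ring
  rw [e1, Finset.mul_sum, ← Finset.sum_sub_distrib, ← Finset.sum_add_distrib]
  refine Finset.sum_congr rfl fun s _ => ?_
  have e2 : ∑ s', Pmat P π s' s * v s' = ∑ a, π s a * ∑ s', P s a s' * v s' := by
    simp_rw [Pmat, Finset.mul_sum, Finset.sum_mul]
    rw [Finset.sum_comm]
    refine Finset.sum_congr rfl fun i _ => Finset.sum_congr rfl fun j _ => ?_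
    ring
  have e3 : ∑ a, π s a * (Q s a - v s + (f' s a - f s a))
      = γ * (∑ a, π s a * ∑ s', P s a s' * v s') - v s + ∑ a, π s a * f' s a := by
    have : v s = ∑ a, π s a * v s := by rw [← Finset.sum_mul, hsum, one_mul]
    conv_rhs => rw [this]
    rw [Finset.mul_sum, ← Finset.sum_sub_distrib, ← Finset.sum_add_distrib]
    refine Finset.sum_congr rfl fun a _ => ?_
    rw [hQ]; ring
  rw [e2, e3]
  have e4 : ∑ a, mupi P d0 γ π s a * f' s a = d s * ∑ a, π s a * f' s a := by
    rw [Finset.mul_sum]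
    exact Finset.sum_congr rfl fun a _ => by rw [mupi, hd]; ring
  rw [e4]; ring

theorem aux_cont {S A E : Type*} [Fintype S] [DecidableEq S] [Fintype A] [TopologicalSpace E]
    (P : S → A → S → ℝ) (hPnn : ∀ s a s', 0 ≤ P s a s')
    (hPsum : ∀ s a, ∑ s', P s a s' = 1)
    (d0 : S → ℝ) (hd0nn : ∀ s, 0 ≤ d0 s) (hd0sum : ∑ s, d0 s = 1)
    (γ : ℝ) (hγ0 : 0 < γ) (hγ1 : γ < 1)
    (π : E → S → A → ℝ)
    (hπpos : ∀ θ s a, 0 < π θ s a) (hπsum : ∀ θ s, ∑ a, π θ s a = 1)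
    (hc : ∀ s a, Continuous fun θ => π θ s a) (s : S) :
    Continuous fun θ => dpi P d0 γ (π θ) s := by
  unfold dpi
  refine continuous_const.mul (continuous_tsum (fun t => ?_)
    (summable_geometric_of_lt_one hγ0.le hγ1)
    (fun t θ => aux_bound P hPnn hPsum d0 hd0nn hd0sum γ hγ0 (π θ) (hπpos θ) (hπsum θ) t s))
  have hM : Continuous fun θ => Pmat P (π θ) :=
    continuous_matrix fun i j => by
      unfold Pmat
      exact continuous_finsetSum _ fun a _ => continuous_const.mul (hc _ _)
  have h2 : Continuous fun θ => (Pmat P (π θ) ^ t).mulVec d0 :=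
    (hM.pow t).matrix_mulVec continuous_const
  exact continuous_const.mul ((continuous_apply s).comp h2)

/-- Product rule at a zero of one factor: the other need only be continuous. -/
theorem aux_prod {E : Type*} [NormedAddCommGroup E] [NormedSpace ℝ E] (c g : E → ℝ) (x : E)
    (g' : E →L[ℝ] ℝ) (hc : ContinuousAt c x) (hg : HasFDerivAt g g' x) (h0 : g x = 0) :
    HasFDerivAt (fun y => c y * g y) (c x • g') x := by
  have h1 : HasFDerivAt (fun y => c x * g y) (c x • g') x := hg.const_mul (c x)
  have hO : g =O[nhds x] fun y => y - x := by
    simpa [h0] using hg.isBigO_sub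
  have hc' : (fun y => c y - c x) =o[nhds x] fun _ => (1 : ℝ) := by
    rw [Asymptotics.isLittleO_one_iff]
    have h := Filter.Tendsto.sub_const hc.tendsto (c x)
    rwa [sub_self] at h
  have h3 : (fun y => (c y - c x) * g y) =o[nhds x] fun y => y - x := by
    have := hc'.mul_isBigO hO.norm_right
    simpa using this
  have h2 : HasFDerivAt (fun y => (c y - c x) * g y) (0 : E →L[ℝ] ℝ) x := by
    rw [hasFDerivAt_iff_isLittleO]
    simpa [h0] using h3
  have := h1.add h2
  simp only [add_zero] at this
  refine this.congr_of_eventuallyEq (Filter.Eventually.of_forall fun y => ?_)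
  simp only [Pi.add_apply]
  ring

/-- Gradient of the KL-regularized objective `V(θ) - λ D(θ, θ̃)`:
it is differentiable with gradient
`∑_{s,a} d_{π_θ}(s) π_θ(a|s) (A^{π_θ}(s,a) − λ 𝐀^{π_θ}_{π̃}(s,a)) ∇_θ log π_θ(a|s)`,
where the advantages are formed from the Bellman solutions `Qr` (for the reward `r`)
and `Qh` (for the pseudo-reward `log π_θ − log π̃`). -/
theorem gradient_kl_regularized_objective
    {S A : Type*} [Fintype S] [DecidableEq S] [Fintype A] {n : ℕ}
    (P : S → A → S → ℝ) (hPnn : ∀ s a s', 0 ≤ P s a s')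
    (hPsum : ∀ s a, ∑ s', P s a s' = 1)
    (d0 : S → ℝ) (hd0nn : ∀ s, 0 ≤ d0 s) (hd0sum : ∑ s, d0 s = 1)
    (γ : ℝ) (hγ0 : 0 < γ) (hγ1 : γ < 1)
    (π : EuclideanSpace ℝ (Fin n) → S → A → ℝ)
    (hπpos : ∀ θ s a, 0 < π θ s a) (hπsum : ∀ θ s, ∑ a, π θ s a = 1)
    (hπdiff : ∀ s a, Differentiable ℝ fun θ => π θ s a)
    (r : S → A → ℝ) (lam : ℝ) (hlam : 0 ≤ lam)
    (θref : EuclideanSpace ℝ (Fin n))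
    (Qr : EuclideanSpace ℝ (Fin n) → S → A → ℝ)
    (hQr : ∀ θ s a, Qr θ s a =
      r s a + γ * ∑ s', P s a s' * ∑ a', π θ s' a' * Qr θ s' a')
    (Qh : EuclideanSpace ℝ (Fin n) → S → A → ℝ)
    (hQh : ∀ θ s a, Qh θ s a =
      (Real.log (π θ s a) - Real.log (π θref s a))
        + γ * ∑ s', P s a s' * ∑ a', π θ s' a' * Qh θ s' a')
    (θ : EuclideanSpace ℝ (Fin n)) :
    DifferentiableAt ℝ
      (fun θ' => (∑ s, ∑ a, mupi P d0 γ (π θ') s a * r s a)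
        - lam * ∑ s, ∑ a, mupi P d0 γ (π θ') s a *
            Real.log (π θ' s a / π θref s a)) θ ∧
    fderiv ℝ
      (fun θ' => (∑ s, ∑ a, mupi P d0 γ (π θ') s a * r s a)
        - lam * ∑ s, ∑ a, mupi P d0 γ (π θ') s a *
            Real.log (π θ' s a / π θref s a)) θ
      = ∑ s, ∑ a,
          (dpi P d0 γ (π θ) s * π θ s a *
            ((Qr θ s a - ∑ b, π θ s b * Qr θ s b)
              - lam * (Qh θ s a - ∑ b, π θ s b * Qh θ s b))) •
          fderiv ℝ (fun θ' => Real.log (π θ' s a)) θ := by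
  classical
  set v : S → ℝ := fun s => (∑ b, π θ s b * Qr θ s b) - lam * ∑ b, π θ s b * Qh θ s b with hv
  set Q : S → A → ℝ := fun s a => Qr θ s a - lam * Qh θ s a with hQdef
  let f : EuclideanSpace ℝ (Fin n) → S → A → ℝ := fun θ' s a =>
    r s a - lam * (Real.log (π θ' s a) - Real.log (π θref s a))
  have hQ : ∀ s a, Q s a = f θ s a + γ * ∑ s', P s a s' * v s' := by
    intro s a
    simp only [hQdef, hv, f]
    rw [hQr, hQh]
    simp_rw [mul_sub, Finset.sum_sub_distrib]
    have : ∑ x, P s a x * (lam * ∑ b, π θ x b * Qh θ x b)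
        = lam * ∑ x, P s a x * ∑ b, π θ x b * Qh θ x b := by
      rw [Finset.mul_sum]
      exact Finset.sum_congr rfl fun _ _ => by ring
    rw [this]; ring
  have hobj : (fun θ' => (∑ s, ∑ a, mupi P d0 γ (π θ') s a * r s a)
        - lam * ∑ s, ∑ a, mupi P d0 γ (π θ') s a *
            Real.log (π θ' s a / π θref s a))
      = fun θ' => (1 - γ) * ∑ s, d0 s * v s + ∑ s, dpi P d0 γ (π θ') s *
          ∑ a, π θ' s a * (Q s a - v s + (-lam) * (Real.log (π θ' s a) - Real.log (π θ s a))) := by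
    funext θ'
    have key := aux_pdl P hPnn hPsum d0 hd0nn hd0sum γ hγ0 hγ1 (π θ') (hπpos θ') (hπsum θ')
      (f θ) (f θ') Q v hQ
    have e1 : (∑ s, ∑ a, mupi P d0 γ (π θ') s a * r s a)
        - lam * ∑ s, ∑ a, mupi P d0 γ (π θ') s a * Real.log (π θ' s a / π θref s a)
        = ∑ s, ∑ a, mupi P d0 γ (π θ') s a * f θ' s a := by
      simp_rw [Finset.mul_sum, ← Finset.sum_sub_distrib]
      refine Finset.sum_congr rfl fun s _ => Finset.sum_congr rfl fun a _ => ?_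
      rw [Real.log_div (hπpos _ _ _).ne' (hπpos _ _ _).ne']
      simp only [f]; ring
    rw [e1, key]
    congr 1
    refine Finset.sum_congr rfl fun s _ => ?_
    congr 1
    refine Finset.sum_congr rfl fun a _ => ?_
    simp only [f]; ring
  have hD : ∀ s a, HasFDerivAt (fun θ' => π θ' s a) (fderiv ℝ (fun θ' => π θ' s a) θ) θ :=
    fun s a => (hπdiff s a θ).hasFDerivAt
  have hL : ∀ s a, HasFDerivAt (fun θ' => Real.log (π θ' s a))
      ((π θ s a)⁻¹ • fderiv ℝ (fun θ' => π θ' s a) θ) θ :=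
    fun s a => (hD s a).log (hπpos _ _ _).ne'
  have hsum0 : ∀ s, ∑ a, fderiv ℝ (fun θ' => π θ' s a) θ = 0 := by
    intro s
    have h1 := HasFDerivAt.fun_sum (u := Finset.univ) fun a _ => hD s a
    simp_rw [hπsum] at h1
    exact h1.unique (hasFDerivAt_const _ _)
  have hg : ∀ s, HasFDerivAt (fun θ' => ∑ a, π θ' s a *
      (Q s a - v s + (-lam) * (Real.log (π θ' s a) - Real.log (π θ s a))))
      (∑ a, (Q s a - v s) • fderiv ℝ (fun θ' => π θ' s a) θ) θ := by
    intro s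
    have h1 := HasFDerivAt.fun_sum (u := Finset.univ) fun a _ => (hD s a).fun_mul
      ((((hL s a).sub_const (Real.log (π θ s a))).const_mul (-lam)).const_add (Q s a - v s))
    refine h1.congr_fderiv (Eq.symm ?_)
    have h2 : ∑ a, (Q s a - v s) • fderiv ℝ (fun θ' => π θ' s a) θ
        = ∑ a, (Q s a - v s) • fderiv ℝ (fun θ' => π θ' s a) θ
          + (-lam) • ∑ a, fderiv ℝ (fun θ' => π θ' s a) θ := by
      rw [hsum0, smul_zero, add_zero]
    rw [h2, Finset.smul_sum, ← Finset.sum_add_distrib]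
    refine Finset.sum_congr rfl fun a _ => ?_
    have hne := (hπpos θ s a).ne'
    ext x
    simp only [ContinuousLinearMap.add_apply, ContinuousLinearMap.smul_apply, smul_eq_mul]
    field_simp
    ring
  have hg0 : ∀ s, ∑ a, π θ s a *
      (Q s a - v s + (-lam) * (Real.log (π θ s a) - Real.log (π θ s a))) = 0 := by
    intro s
    simp only [sub_self, mul_zero, add_zero, mul_sub, Finset.sum_sub_distrib]
    rw [← Finset.sum_mul, hπsum, one_mul]
    simp only [hQdef, hv, mul_sub, Finset.sum_sub_distrib, Finset.mul_sum]
    rw [sub_sub_sub_cancel_left, sub_eq_zero]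
    exact Finset.sum_congr rfl fun _ _ => by ring
  have main := (HasFDerivAt.fun_sum (u := Finset.univ) fun s _ =>
    aux_prod (fun θ' => dpi P d0 γ (π θ') s) _ θ _
      (aux_cont P hPnn hPsum d0 hd0nn hd0sum γ hγ0 hγ1 π hπpos hπsum
        (fun s a => (hπdiff s a).continuous) s).continuousAt (hg s) (hg0 s)).const_add
      ((1 - γ) * ∑ s, d0 s * v s)
  rw [hobj]
  refine ⟨main.differentiableAt, ?_⟩
  rw [main.fderiv]
  refine Finset.sum_congr rfl fun s _ => ?_
  rw [Finset.smul_sum]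
  refine Finset.sum_congr rfl fun a _ => ?_
  rw [(hL s a).fderiv, smul_smul, smul_smul]
  congr 1
  have hne := (hπpos θ s a).ne'
  simp only [hQdef, hv]
  field_simp
  ring
end
end

section
/- Proposition 1 (error bound for the biased policy gradient). Let π = π_θ and π̃ = π_{θ̃} be two policies from a differentiable parametrization with π̃(a|s) > 0 and π(a|s) > 0 for all (s,a), let r : S×A → ℝ and λ ≥ 0. Suppose there are constants ζ₁, ζ₂ ≥ 0 such that for all states s, ∑_a π(a|s) ‖∇_θ log π(a|s)‖ ≤ ζ₁, and for all (s,a), |A^π(s,a) − λ 𝐀^π_{π̃}(s,a)| ≤ ζ₂. Define the gradient bias δ = ‖∑_{s,a} (d_π(s) − d_{π̃}(s)) π(a|s) (A^π(s,a) − λ 𝐀^π_{π̃}(s,a)) ∇_θ log π(a|s)‖. Then δ² ≤ 2 (γ/(1−γ))² ζ₁² ζ₂² · D_KL^{d_π}(π, π̃). -/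
open scoped BigOperators

noncomputable section

lemma pinsker_scalar_aux (x : ℝ) (hx : 0 < x) :
    0 ≤ Real.log x - (5 * x ^ 2 - 4 * x - 1) / (2 * x ^ 2 + 4 * x) := by
  set g : ℝ → ℝ := fun x => Real.log x - (5 * x ^ 2 - 4 * x - 1) / (2 * x ^ 2 + 4 * x) with hg
  have hd : ∀ y : ℝ, 0 < y → HasDerivAt g ((y - 1) ^ 3 / (y ^ 2 * (y + 2) ^ 2)) y := by
    intro y hy
    have hne : 2 * y ^ 2 + 4 * y ≠ 0 := by positivity
    have h1 : HasDerivAt (fun x : ℝ => 5 * x ^ 2 - 4 * x - 1) (10 * y - 4) y := by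
      have := (((hasDerivAt_pow 2 y).const_mul 5).sub ((hasDerivAt_id y).const_mul 4)).sub_const 1
      refine HasDerivAt.congr_deriv this ?_
      norm_num; ring
    have h2 : HasDerivAt (fun x : ℝ => 2 * x ^ 2 + 4 * x) (4 * y + 4) y := by
      have := ((hasDerivAt_pow 2 y).const_mul 2).add ((hasDerivAt_id y).const_mul 4)
      refine HasDerivAt.congr_deriv this ?_
      norm_num; ring
    have h3 := (Real.hasDerivAt_log hy.ne').sub (h1.div h2 hne)
    refine h3.congr_deriv ?_
    have : y + 2 ≠ 0 := by positivity
    have e : 2 * y ^ 2 + 4 * y = 2 * y * (y + 2) := by ring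
    rw [e]
    field_simp
    ring
  have g1 : g 1 = 0 := by simp [hg]; norm_num
  change 0 ≤ g x
  rw [← g1]
  rcases le_total 1 x with h | h
  · have hm : MonotoneOn g (Set.Ici 1) := by
      apply monotoneOn_of_deriv_nonneg (convex_Ici 1)
      · intro y hy
        exact (hd y (lt_of_lt_of_le one_pos hy)).continuousAt.continuousWithinAt
      · intro y hy
        rw [interior_Ici] at hy
        exact (hd y (lt_trans one_pos hy)).differentiableAt.differentiableWithinAt
      · intro y hy
        rw [interior_Ici] at hy
        have hy' : (1 : ℝ) < y := hy
        rw [(hd y (lt_trans one_pos hy')).deriv]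
        have : 0 ≤ y - 1 := by linarith
        positivity
    exact hm (by simp) h h
  · have hm : AntitoneOn g (Set.Ioc 0 1) := by
      apply antitoneOn_of_deriv_nonpos (convex_Ioc 0 1)
      · intro y hy
        exact (hd y hy.1).continuousAt.continuousWithinAt
      · intro y hy
        rw [interior_Ioc] at hy
        exact (hd y hy.1).differentiableAt.differentiableWithinAt
      · intro y hy
        rw [interior_Ioc] at hy
        rw [(hd y hy.1).deriv]
        have h0 : 0 ≤ 1 - y := by linarith [hy.2]
        have h3 : (y - 1) ^ 3 = - (1 - y) ^ 3 := by ring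
        rw [h3, neg_div]
        have := hy.1
        have : 0 ≤ (1 - y) ^ 3 / (y ^ 2 * (y + 2) ^ 2) := by positivity
        linarith
    exact hm ⟨hx, h⟩ (by simp) h

lemma pinsker_scalar_pq (p q : ℝ) (hp : 0 < p) (hq : 0 < q) :
    (p - q) ^ 2 ≤ ((2 * p + 4 * q) / 3) * (p * Real.log (p / q) - p + q) := by
  have h := pinsker_scalar_aux (p / q) (by positivity)
  set L := Real.log (p / q)
  have e : (5 * (p / q) ^ 2 - 4 * (p / q) - 1) / (2 * (p / q) ^ 2 + 4 * (p / q))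
      = (5 * p ^ 2 - 4 * p * q - q ^ 2) / (p * (2 * p + 4 * q)) := by
    have h1 : 2 * (p / q) ^ 2 + 4 * (p / q) ≠ 0 := by positivity
    have h2 : p * (2 * p + 4 * q) ≠ 0 := by positivity
    rw [div_eq_div_iff h1 h2]
    field_simp
  rw [e, sub_nonneg, div_le_iff₀ (by positivity)] at h
  nlinarith

lemma pinsker_fin {A : Type*} [Fintype A] (p q : A → ℝ) (hp : ∀ a, 0 < p a)
    (hq : ∀ a, 0 < q a) (hps : ∑ a, p a = 1) (hqs : ∑ a, q a = 1) :
    (∑ a, |p a - q a|) ^ 2 ≤ 2 * ∑ a, p a * Real.log (p a / q a) := by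
  have hk : ∀ a, 0 ≤ p a * Real.log (p a / q a) - p a + q a := by
    intro a
    have h := pinsker_scalar_pq (p a) (q a) (hp a) (hq a)
    have h0 : 0 < (2 * p a + 4 * q a) / 3 := by linarith [hp a, hq a]
    exact nonneg_of_mul_nonneg_right (le_trans (sq_nonneg _) h) h0
  have h := Finset.sum_sq_le_sum_mul_sum_of_sq_le_mul Finset.univ
    (r := fun a => |p a - q a|) (f := fun a => (2 * p a + 4 * q a) / 3)
    (g := fun a => p a * Real.log (p a / q a) - p a + q a)
    (fun a _ => by linarith [hp a, hq a]) (fun a _ => hk a)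
    (fun a _ => by rw [sq_abs]; exact pinsker_scalar_pq _ _ (hp a) (hq a))
  refine h.trans (le_of_eq ?_)
  rw [← Finset.sum_div, Finset.sum_add_distrib, Finset.sum_add_distrib, Finset.sum_sub_distrib,
    ← Finset.mul_sum, ← Finset.mul_sum, hps, hqs]
  ring

section dpiLemmas

variable {S A : Type*} [Fintype S] [DecidableEq S] [Fintype A]

lemma pmat_nonneg (P : S → A → S → ℝ) (hPnn : ∀ s a s', 0 ≤ P s a s')
    (π : S → A → ℝ) (hπ : ∀ s a, 0 < π s a) (s' s : S) : 0 ≤ Pmat P π s' s :=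
  Finset.sum_nonneg fun a _ => mul_nonneg (hPnn s a s') (hπ s a).le

lemma pmat_sum (P : S → A → S → ℝ) (hPsum : ∀ s a, ∑ s', P s a s' = 1)
    (π : S → A → ℝ) (hπs : ∀ s, ∑ a, π s a = 1) (s : S) : ∑ s', Pmat P π s' s = 1 := by
  unfold Pmat
  rw [Finset.sum_comm]
  simp_rw [← Finset.sum_mul, hPsum, one_mul, hπs]

lemma pow_mulVec_dist (M : Matrix S S ℝ) (hM : ∀ i j, 0 ≤ M i j) (hMs : ∀ j, ∑ i, M i j = 1)
    (d0 : S → ℝ) (hd0nn : ∀ s, 0 ≤ d0 s) (hd0sum : ∑ s, d0 s = 1) (t : ℕ) :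
    (∀ s, 0 ≤ (M ^ t).mulVec d0 s) ∧ ∑ s, (M ^ t).mulVec d0 s = 1 := by
  induction t with
  | zero => simpa using ⟨hd0nn, hd0sum⟩
  | succ t ih =>
    rw [pow_succ', ← Matrix.mulVec_mulVec]
    refine ⟨fun s => Finset.sum_nonneg fun j _ => mul_nonneg (hM _ _) (ih.1 j), ?_⟩
    simp only [Matrix.mulVec, dotProduct] at ih ⊢
    rw [Finset.sum_comm]
    simp_rw [← Finset.sum_mul, hMs, one_mul]
    exact ih.2

lemma summable_occ (M : Matrix S S ℝ) (hM : ∀ i j, 0 ≤ M i j) (hMs : ∀ j, ∑ i, M i j = 1)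
    (d0 : S → ℝ) (hd0nn : ∀ s, 0 ≤ d0 s) (hd0sum : ∑ s, d0 s = 1)
    (γ : ℝ) (hγ0 : 0 < γ) (hγ1 : γ < 1) (s : S) :
    Summable fun t : ℕ => γ ^ t * ((M ^ t).mulVec d0 s) := by
  refine Summable.of_nonneg_of_le (fun t => ?_) (fun t => ?_)
    (summable_geometric_of_lt_one hγ0.le hγ1)
  · exact mul_nonneg (by positivity) ((pow_mulVec_dist M hM hMs d0 hd0nn hd0sum t).1 s)
  · have h := pow_mulVec_dist M hM hMs d0 hd0nn hd0sum t
    have h1 : (M ^ t).mulVec d0 s ≤ 1 := by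
      rw [← h.2]
      exact Finset.single_le_sum (f := (M ^ t).mulVec d0) (fun i _ => h.1 i) (Finset.mem_univ s)
    exact mul_le_of_le_one_right (by positivity) h1

lemma dpi_nonneg (P : S → A → S → ℝ) (hPnn : ∀ s a s', 0 ≤ P s a s')
    (hPsum : ∀ s a, ∑ s', P s a s' = 1)
    (d0 : S → ℝ) (hd0nn : ∀ s, 0 ≤ d0 s) (hd0sum : ∑ s, d0 s = 1)
    (γ : ℝ) (hγ0 : 0 < γ) (hγ1 : γ < 1) (π : S → A → ℝ) (hπ : ∀ s a, 0 < π s a)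
    (hπs : ∀ s, ∑ a, π s a = 1) (s : S) : 0 ≤ dpi P d0 γ π s := by
  unfold dpi
  refine mul_nonneg (by linarith) (tsum_nonneg fun t => mul_nonneg (by positivity) ?_)
  exact (pow_mulVec_dist _ (pmat_nonneg P hPnn π hπ) (pmat_sum P hPsum π hπs) d0 hd0nn hd0sum t).1 s

lemma dpi_fix (P : S → A → S → ℝ) (hPnn : ∀ s a s', 0 ≤ P s a s')
    (hPsum : ∀ s a, ∑ s', P s a s' = 1)
    (d0 : S → ℝ) (hd0nn : ∀ s, 0 ≤ d0 s) (hd0sum : ∑ s, d0 s = 1)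
    (γ : ℝ) (hγ0 : 0 < γ) (hγ1 : γ < 1) (π : S → A → ℝ) (hπ : ∀ s a, 0 < π s a)
    (hπs : ∀ s, ∑ a, π s a = 1) (s : S) :
    dpi P d0 γ π s = (1 - γ) * d0 s + γ * ∑ j, Pmat P π s j * dpi P d0 γ π j := by
  have hs := summable_occ _ (pmat_nonneg P hPnn π hπ) (pmat_sum P hPsum π hπs) d0 hd0nn hd0sum
    γ hγ0 hγ1
  unfold dpi
  rw [(hs s).tsum_eq_zero_add]
  have e : ∀ t : ℕ, γ ^ (t + 1) * ((Pmat P π ^ (t + 1)).mulVec d0 s)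
      = ∑ j, γ * Pmat P π s j * (γ ^ t * ((Pmat P π ^ t).mulVec d0 j)) := by
    intro t
    rw [pow_succ' (Pmat P π), ← Matrix.mulVec_mulVec, Matrix.mulVec, dotProduct, Finset.mul_sum]
    refine Finset.sum_congr rfl fun j _ => ?_
    ring
  simp_rw [e]
  rw [Summable.tsum_finsetSum (fun j _ => (hs j).mul_left _)]
  simp_rw [tsum_mul_left]
  simp only [pow_zero, Matrix.one_mulVec, one_mul, mul_add, Finset.mul_sum]
  congr 1
  refine Finset.sum_congr rfl fun j _ => ?_
  ring

lemma dpi_sum (P : S → A → S → ℝ) (hPnn : ∀ s a s', 0 ≤ P s a s')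
    (hPsum : ∀ s a, ∑ s', P s a s' = 1)
    (d0 : S → ℝ) (hd0nn : ∀ s, 0 ≤ d0 s) (hd0sum : ∑ s, d0 s = 1)
    (γ : ℝ) (hγ0 : 0 < γ) (hγ1 : γ < 1) (π : S → A → ℝ) (hπ : ∀ s a, 0 < π s a)
    (hπs : ∀ s, ∑ a, π s a = 1) : ∑ s, dpi P d0 γ π s = 1 := by
  have h : ∑ s, dpi P d0 γ π s
      = ∑ s, ((1 - γ) * d0 s + γ * ∑ j, Pmat P π s j * dpi P d0 γ π j) :=
    Finset.sum_congr rfl fun s _ =>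
      dpi_fix P hPnn hPsum d0 hd0nn hd0sum γ hγ0 hγ1 π hπ hπs s
  rw [Finset.sum_add_distrib, ← Finset.mul_sum, ← Finset.mul_sum, hd0sum, Finset.sum_comm] at h
  simp_rw [← Finset.sum_mul, pmat_sum P hPsum π hπs, one_mul] at h
  have h1 : (1 - γ) * (∑ s, dpi P d0 γ π s - 1) = 0 := by linarith
  rcases mul_eq_zero.1 h1 with h2 | h2 <;> linarith

lemma dpi_diff (P : S → A → S → ℝ) (hPnn : ∀ s a s', 0 ≤ P s a s')
    (hPsum : ∀ s a, ∑ s', P s a s' = 1)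
    (d0 : S → ℝ) (hd0nn : ∀ s, 0 ≤ d0 s) (hd0sum : ∑ s, d0 s = 1)
    (γ : ℝ) (hγ0 : 0 < γ) (hγ1 : γ < 1) (π π' : S → A → ℝ) (hπ : ∀ s a, 0 < π s a)
    (hπs : ∀ s, ∑ a, π s a = 1) (hπ' : ∀ s a, 0 < π' s a) (hπs' : ∀ s, ∑ a, π' s a = 1) :
    ∑ s, |dpi P d0 γ π s - dpi P d0 γ π' s|
      ≤ γ / (1 - γ) * ∑ s, dpi P d0 γ π s * ∑ a, |π s a - π' s a| := by
  have f1 := dpi_fix P hPnn hPsum d0 hd0nn hd0sum γ hγ0 hγ1 π hπ hπs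
  have f2 := dpi_fix P hPnn hPsum d0 hd0nn hd0sum γ hγ0 hγ1 π' hπ' hπs'
  have hn := dpi_nonneg P hPnn hPsum d0 hd0nn hd0sum γ hγ0 hγ1 π hπ hπs
  set d := dpi P d0 γ π
  set d' := dpi P d0 γ π'
  have key : ∀ s, |d s - d' s| ≤ γ * ∑ j, ∑ a, P j a s * (d j * |π j a - π' j a|)
      + γ * ∑ j, Pmat P π' s j * |d j - d' j| := by
    intro s
    have e : d s - d' s = γ * ∑ j, ∑ a, P j a s * (d j * (π j a - π' j a))
        + γ * ∑ j, Pmat P π' s j * (d j - d' j) := by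
      rw [f1 s, f2 s, add_sub_add_left_eq_sub, ← mul_sub, ← mul_add, ← Finset.sum_sub_distrib,
        ← Finset.sum_add_distrib]
      congr 1
      refine Finset.sum_congr rfl fun j _ => ?_
      have e2 : ∑ a, P j a s * (d j * (π j a - π' j a))
          = (Pmat P π s j - Pmat P π' s j) * d j := by
        unfold Pmat
        rw [← Finset.sum_sub_distrib, Finset.sum_mul]
        exact Finset.sum_congr rfl fun a _ => by ring
      rw [e2]; ring
    rw [e]
    refine (abs_add_le _ _).trans (add_le_add ?_ ?_)
    · rw [abs_mul, abs_of_pos hγ0]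
      refine mul_le_mul_of_nonneg_left ?_ hγ0.le
      refine (Finset.abs_sum_le_sum_abs _ _).trans (Finset.sum_le_sum fun j _ => ?_)
      refine (Finset.abs_sum_le_sum_abs _ _).trans (Finset.sum_le_sum fun a _ => ?_)
      rw [abs_mul, abs_mul, abs_of_nonneg (hPnn _ _ _), abs_of_nonneg (hn j)]
    · rw [abs_mul, abs_of_pos hγ0]
      refine mul_le_mul_of_nonneg_left ?_ hγ0.le
      refine (Finset.abs_sum_le_sum_abs _ _).trans (Finset.sum_le_sum fun j _ => ?_)
      rw [abs_mul, abs_of_nonneg (pmat_nonneg P hPnn π' hπ' _ _)]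
  have h := Finset.sum_le_sum fun s (_ : s ∈ Finset.univ) => key s
  rw [Finset.sum_add_distrib, ← Finset.mul_sum, ← Finset.mul_sum] at h
  have e1 : ∑ s, ∑ j, ∑ a, P j a s * (d j * |π j a - π' j a|)
      = ∑ j, d j * ∑ a, |π j a - π' j a| := by
    rw [Finset.sum_comm]
    refine Finset.sum_congr rfl fun j _ => ?_
    rw [Finset.sum_comm, Finset.mul_sum]
    refine Finset.sum_congr rfl fun a _ => ?_
    rw [← Finset.sum_mul, hPsum, one_mul]
  have e2 : ∑ s, ∑ j, Pmat P π' s j * |d j - d' j| = ∑ j, |d j - d' j| := by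
    rw [Finset.sum_comm]
    refine Finset.sum_congr rfl fun j _ => ?_
    rw [← Finset.sum_mul, pmat_sum P hPsum π' hπs', one_mul]
  rw [e1, e2] at h
  rw [div_mul_eq_mul_div, le_div_iff₀ (by linarith)]
  linarith

end dpiLemmas

/-- Proposition 1: the squared norm of the bias introduced by omitting the state ratio
is bounded by `2 (γ/(1−γ))² ζ₁² ζ₂²` times the conditional KL divergence
`D_KL^{d_π}(π, π̃) = ∑_s d_π(s) ∑_a π(a|s) log(π(a|s)/π̃(a|s))`. -/
theorem biased_gradient_error_bound
    {S A : Type*} [Fintype S] [DecidableEq S] [Fintype A] {n : ℕ}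
    (P : S → A → S → ℝ) (hPnn : ∀ s a s', 0 ≤ P s a s')
    (hPsum : ∀ s a, ∑ s', P s a s' = 1)
    (d0 : S → ℝ) (hd0nn : ∀ s, 0 ≤ d0 s) (hd0sum : ∑ s, d0 s = 1)
    (γ : ℝ) (hγ0 : 0 < γ) (hγ1 : γ < 1)
    (π : EuclideanSpace ℝ (Fin n) → S → A → ℝ)
    (hπpos : ∀ θ s a, 0 < π θ s a) (hπsum : ∀ θ s, ∑ a, π θ s a = 1)
    (hπdiff : ∀ s a, Differentiable ℝ fun θ => π θ s a)
    (r : S → A → ℝ) (lam : ℝ) (hlam : 0 ≤ lam)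
    (θ θref : EuclideanSpace ℝ (Fin n))
    -- `Q^π(r)`, the Bellman solution for the reward `r` under `π = π_θ`
    (Qr : S → A → ℝ)
    (hQr : ∀ s a, Qr s a =
      r s a + γ * ∑ s', P s a s' * ∑ a', π θ s' a' * Qr s' a')
    -- `Q^π(h)`, the Bellman solution for the pseudo-reward `h = log π − log π̃` under `π`
    (Qh : S → A → ℝ)
    (hQh : ∀ s a, Qh s a =
      (Real.log (π θ s a) - Real.log (π θref s a))
        + γ * ∑ s', P s a s' * ∑ a', π θ s' a' * Qh s' a')
    (ζ₁ ζ₂ : ℝ) (hζ₁ : 0 ≤ ζ₁) (hζ₂ : 0 ≤ ζ₂)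
    (hgradbound : ∀ s, ∑ a, π θ s a *
      ‖gradient (fun θ' => Real.log (π θ' s a)) θ‖ ≤ ζ₁)
    (hadvbound : ∀ s a,
      |(Qr s a - ∑ b, π θ s b * Qr s b)
        - lam * (Qh s a - ∑ b, π θ s b * Qh s b)| ≤ ζ₂) :
    ‖∑ s, ∑ a, ((dpi P d0 γ (π θ) s - dpi P d0 γ (π θref) s) * π θ s a *
        ((Qr s a - ∑ b, π θ s b * Qr s b)
          - lam * (Qh s a - ∑ b, π θ s b * Qh s b))) •
        gradient (fun θ' => Real.log (π θ' s a)) θ‖ ^ 2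
      ≤ 2 * (γ / (1 - γ)) ^ 2 * ζ₁ ^ 2 * ζ₂ ^ 2 *
          ∑ s, dpi P d0 γ (π θ) s *
            ∑ a, π θ s a * Real.log (π θ s a / π θref s a) := by
  have hn := dpi_nonneg P hPnn hPsum d0 hd0nn hd0sum γ hγ0 hγ1 (π θ) (hπpos θ) (hπsum θ)
  have hs := dpi_sum P hPnn hPsum d0 hd0nn hd0sum γ hγ0 hγ1 (π θ) (hπpos θ) (hπsum θ)
  have hdiff := dpi_diff P hPnn hPsum d0 hd0nn hd0sum γ hγ0 hγ1 (π θ) (π θref)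
    (hπpos θ) (hπsum θ) (hπpos θref) (hπsum θref)
  have hpin := fun s => pinsker_fin (π θ s) (π θref s) (hπpos θ s) (hπpos θref s)
    (hπsum θ s) (hπsum θref s)
  set d := dpi P d0 γ (π θ)
  set d' := dpi P d0 γ (π θref)
  set K : S → ℝ := fun s => ∑ a, π θ s a * Real.log (π θ s a / π θref s a) with hK
  set T : S → ℝ := fun s => ∑ a, |π θ s a - π θref s a| with hT
  have hT0 : ∀ s, 0 ≤ T s := fun s => Finset.sum_nonneg fun a _ => abs_nonneg _
  have hK0 : ∀ s, 0 ≤ K s := fun s => by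
    have h1 : T s ^ 2 ≤ 2 * K s := hpin s
    nlinarith [sq_nonneg (T s)]
  have hcs : (∑ s, d s * T s) ^ 2 ≤ 2 * ∑ s, d s * K s := by
    have h := Finset.sum_sq_le_sum_mul_sum_of_sq_le_mul Finset.univ
      (r := fun s => d s * T s) (f := fun s => d s) (g := fun s => d s * (2 * K s))
      (fun s _ => hn s) (fun s _ => mul_nonneg (hn s) (by linarith [hK0 s]))
      (fun s _ => by
        have h1 : T s ^ 2 ≤ 2 * K s := hpin s
        have h2 := mul_le_mul_of_nonneg_left h1 (sq_nonneg (d s))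
        calc (d s * T s) ^ 2 = d s ^ 2 * T s ^ 2 := by ring
          _ ≤ d s ^ 2 * (2 * K s) := h2
          _ = d s * (d s * (2 * K s)) := by ring)
    rw [hs, one_mul] at h
    refine h.trans (le_of_eq ?_)
    rw [Finset.mul_sum]
    exact Finset.sum_congr rfl fun s _ => by ring
  have hnorm : ‖∑ s, ∑ a, ((d s - d' s) * π θ s a *
        ((Qr s a - ∑ b, π θ s b * Qr s b)
          - lam * (Qh s a - ∑ b, π θ s b * Qh s b))) •
        gradient (fun θ' => Real.log (π θ' s a)) θ‖
      ≤ γ / (1 - γ) * (∑ s, d s * T s) * (ζ₁ * ζ₂) := by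
    calc _ ≤ ∑ s, |d s - d' s| * (ζ₁ * ζ₂) := by
          refine (norm_sum_le _ _).trans (Finset.sum_le_sum fun s _ => ?_)
          refine (norm_sum_le _ _).trans ?_
          calc _ ≤ ∑ a, |d s - d' s| * ζ₂ *
                (π θ s a * ‖gradient (fun θ' => Real.log (π θ' s a)) θ‖) := by
                refine Finset.sum_le_sum fun a _ => ?_
                rw [norm_smul, Real.norm_eq_abs, abs_mul, abs_mul, abs_of_pos (hπpos θ s a)]
                have h1 := mul_le_mul_of_nonneg_left (hadvbound s a)
                  (mul_nonneg (mul_nonneg (abs_nonneg (d s - d' s)) (hπpos θ s a).le)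
                    (norm_nonneg (gradient (fun θ' => Real.log (π θ' s a)) θ)))
                linarith
            _ = |d s - d' s| * ζ₂ *
                ∑ a, (π θ s a * ‖gradient (fun θ' => Real.log (π θ' s a)) θ‖) := by
                rw [Finset.mul_sum]
            _ ≤ |d s - d' s| * ζ₂ * ζ₁ :=
                mul_le_mul_of_nonneg_left (hgradbound s) (mul_nonneg (abs_nonneg _) hζ₂)
            _ = _ := by ring
      _ = (∑ s, |d s - d' s|) * (ζ₁ * ζ₂) := by rw [Finset.sum_mul]
      _ ≤ _ := mul_le_mul_of_nonneg_right hdiff (mul_nonneg hζ₁ hζ₂)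
  calc _ ≤ (γ / (1 - γ) * (∑ s, d s * T s) * (ζ₁ * ζ₂)) ^ 2 :=
        pow_le_pow_left₀ (norm_nonneg _) hnorm 2
    _ = ((γ / (1 - γ)) ^ 2 * ζ₁ ^ 2 * ζ₂ ^ 2) * (∑ s, d s * T s) ^ 2 := by ring
    _ ≤ ((γ / (1 - γ)) ^ 2 * ζ₁ ^ 2 * ζ₂ ^ 2) * (2 * ∑ s, d s * K s) :=
        mul_le_mul_of_nonneg_left hcs (by positivity)
    _ = _ := by ring
end
end

section
/- KL bound on the difference of discounted state distributions. For a finite MDP with discount γ ∈ (0,1) and two policies π and π̃ with π̃(a|s) > 0 whenever π(a|s) > 0, the discounted state distributions satisfy ‖d_π − d_{π̃}‖₁ ≤ (γ/(1−γ)) · √(2 D_KL^{d_π}(π, π̃)). -/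
open scoped BigOperators

noncomputable section

lemma aux_hasDeriv (x : ℝ) (hx : 0 < x) :
    HasDerivAt (fun x : ℝ => Real.log x - (x - 1) * (5 * x + 1) / (2 * x * (x + 2)))
      ((x - 1) ^ 3 / (x ^ 2 * (x + 2) ^ 2)) x := by
  have h2 : 2 * x * (x + 2) ≠ 0 := by positivity
  have hn : HasDerivAt (fun x : ℝ => (x - 1) * (5 * x + 1)) (1 * (5 * x + 1) + (x - 1) * (5 * 1)) x :=
    ((hasDerivAt_id' x).sub_const 1).mul (((hasDerivAt_id' x).const_mul 5).add_const 1)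
  have hd : HasDerivAt (fun x : ℝ => 2 * x * (x + 2)) (2 * 1 * (x + 2) + 2 * x * 1) x :=
    ((hasDerivAt_id' x).const_mul 2).mul ((hasDerivAt_id' x).add_const 2)
  have := (Real.hasDerivAt_log hx.ne').sub (hn.div hd h2)
  refine this.congr_deriv ?_
  have : x + 2 ≠ 0 := by positivity
  field_simp
  ring

lemma aux_log (x : ℝ) (hx : 0 < x) :
    0 ≤ Real.log x - (x - 1) * (5 * x + 1) / (2 * x * (x + 2)) := by
  set f := (fun x : ℝ => Real.log x - (x - 1) * (5 * x + 1) / (2 * x * (x + 2))) with hf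
  have h1 : f 1 = 0 := by simp [hf]
  change 0 ≤ f x
  rw [← h1]
  rcases le_total 1 x with h | h
  · have hm : MonotoneOn f (Set.Ici 1) := by
      apply monotoneOn_of_hasDerivWithinAt_nonneg (f' := fun x => (x - 1) ^ 3 / (x ^ 2 * (x + 2) ^ 2))
        (convex_Ici 1)
      · intro y hy
        exact (aux_hasDeriv y (lt_of_lt_of_le one_pos hy)).continuousAt.continuousWithinAt
      · intro y hy
        rw [interior_Ici] at hy
        exact (aux_hasDeriv y (lt_trans one_pos hy)).hasDerivWithinAt
      · intro y hy
        rw [interior_Ici] at hy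
        have : 0 ≤ y - 1 := sub_nonneg.2 (le_of_lt hy)
        positivity
    exact hm (Set.mem_Ici.2 le_rfl) h h
  · have hm : AntitoneOn f (Set.Ioc 0 1) := by
      apply antitoneOn_of_hasDerivWithinAt_nonpos (f' := fun x => (x - 1) ^ 3 / (x ^ 2 * (x + 2) ^ 2))
        (convex_Ioc 0 1)
      · intro y hy
        exact (aux_hasDeriv y hy.1).continuousAt.continuousWithinAt
      · intro y hy
        rw [interior_Ioc] at hy
        exact (aux_hasDeriv y hy.1).hasDerivWithinAt
      · intro y hy
        rw [interior_Ioc] at hy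
        apply div_nonpos_of_nonpos_of_nonneg _ (by positivity)
        have : 0 ≤ (1 - y) ^ 3 := pow_nonneg (by linarith [hy.2]) 3
        linarith [show (y - 1) ^ 3 = - (1 - y) ^ 3 by ring]
    exact hm ⟨hx, h⟩ ⟨one_pos, le_rfl⟩ h

lemma aux_pq (p q : ℝ) (hp : 0 ≤ p) (hq : 0 ≤ q) (h : 0 < p → 0 < q) :
    (p - q) ^ 2 ≤ ((2 * p + 4 * q) / 3) * (p * Real.log (p / q) - p + q) := by
  rcases hp.eq_or_lt with rfl | hp
  · simp; nlinarith [sq_nonneg q]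
  have hq := h hp
  have hl := aux_log (p / q) (by positivity)
  have e : (p / q - 1) * (5 * (p / q) + 1) / (2 * (p / q) * (p / q + 2))
      = (p - q) * (5 * p + q) / (2 * p * (p + 2 * q)) := by
    field_simp
  rw [e, sub_nonneg, div_le_iff₀ (by positivity)] at hl
  nlinarith

lemma aux_nonneg (p q : ℝ) (hp : 0 ≤ p) (hq : 0 ≤ q) (h : 0 < p → 0 < q) :
    0 ≤ p * Real.log (p / q) - p + q := by
  by_contra hc
  push Not at hc
  have h1 := aux_pq p q hp hq h
  rcases hq.eq_or_lt with rfl | hq'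
  · have : p = 0 := by
      by_contra h0
      exact lt_irrefl _ (h (lt_of_le_of_ne hp (Ne.symm h0)))
    simp [this] at hc
  · nlinarith [sq_nonneg (p - q), mul_pos (show 0 < (2 * p + 4 * q) / 3 by positivity) (neg_pos.2 hc)]

lemma aux_pinsker {S A : Type*} [Fintype S] [Fintype A] (d : S → ℝ) (hd : ∀ s, 0 ≤ d s)
    (hds : ∑ s, d s = 1) (π πt : S → A → ℝ)
    (hπnn : ∀ s a, 0 ≤ π s a) (hπsum : ∀ s, ∑ a, π s a = 1)
    (hπtnn : ∀ s a, 0 ≤ πt s a) (hπtsum : ∀ s, ∑ a, πt s a = 1)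
    (habs : ∀ s a, 0 < π s a → 0 < πt s a) :
    ∑ s, d s * ∑ a, |π s a - πt s a| ≤
      Real.sqrt (2 * ∑ s, d s * ∑ a, π s a * Real.log (π s a / πt s a)) := by
  apply Real.le_sqrt_of_sq_le
  have key := Finset.sum_sq_le_sum_mul_sum_of_sq_le_mul (Finset.univ : Finset (S × A))
    (r := fun x => d x.1 * |π x.1 x.2 - πt x.1 x.2|)
    (f := fun x => d x.1 * ((2 * π x.1 x.2 + 4 * πt x.1 x.2) / 3))
    (g := fun x => d x.1 * (π x.1 x.2 * Real.log (π x.1 x.2 / πt x.1 x.2) - π x.1 x.2 + πt x.1 x.2))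
    (fun x _ => mul_nonneg (hd _) (by have := hπnn x.1 x.2; have := hπtnn x.1 x.2; positivity))
    (fun x _ => mul_nonneg (hd _) (aux_nonneg _ _ (hπnn _ _) (hπtnn _ _) (habs _ _)))
    (fun x _ => by
      rw [mul_pow, sq_abs]
      have := mul_le_mul_of_nonneg_left
        (aux_pq _ _ (hπnn x.1 x.2) (hπtnn x.1 x.2) (habs _ _)) (sq_nonneg (d x.1))
      linarith)
  simp only [Fintype.sum_prod_type, ← Finset.mul_sum, ← Finset.sum_div, Finset.sum_add_distrib,
    Finset.sum_sub_distrib, hπsum, hπtsum] at key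
  rw [← Finset.sum_mul, hds] at key
  refine key.trans (le_of_eq ?_)
  norm_num

lemma aux_Pmat {S A : Type*} [Fintype S] [Fintype A]
    (P : S → A → S → ℝ) (hPsum : ∀ s a, ∑ s', P s a s' = 1)
    (π : S → A → ℝ) (hπsum : ∀ s, ∑ a, π s a = 1) (s : S) : ∑ s', Pmat P π s' s = 1 := by
  unfold Pmat
  rw [Finset.sum_comm]
  simp [← Finset.sum_mul, hPsum, hπsum]

lemma aux_Pmat_nn {S A : Type*} [Fintype A]
    (P : S → A → S → ℝ) (hPnn : ∀ s a s', 0 ≤ P s a s')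
    (π : S → A → ℝ) (hπnn : ∀ s a, 0 ≤ π s a) (s s' : S) : 0 ≤ Pmat P π s' s :=
  Finset.sum_nonneg fun a _ => mul_nonneg (hPnn _ _ _) (hπnn _ _)

lemma aux_sum_mulVec {S : Type*} [Fintype S] (M : Matrix S S ℝ) (h : ∀ s, ∑ s', M s' s = 1)
    (v : S → ℝ) : ∑ s, M.mulVec v s = ∑ s, v s := by
  simp only [Matrix.mulVec, dotProduct]
  rw [Finset.sum_comm]
  simp [← Finset.sum_mul, h]

lemma aux_dpi {S A : Type*} [Fintype S] [DecidableEq S] [Fintype A]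
    (P : S → A → S → ℝ) (hPnn : ∀ s a s', 0 ≤ P s a s')
    (hPsum : ∀ s a, ∑ s', P s a s' = 1)
    (d0 : S → ℝ) (hd0nn : ∀ s, 0 ≤ d0 s) (hd0sum : ∑ s, d0 s = 1)
    (γ : ℝ) (hγ0 : 0 < γ) (hγ1 : γ < 1)
    (π : S → A → ℝ)
    (hπnn : ∀ s a, 0 ≤ π s a) (hπsum : ∀ s, ∑ a, π s a = 1) :
    (∀ s, 0 ≤ dpi P d0 γ π s) ∧ (∑ s, dpi P d0 γ π s = 1) ∧
    ∀ s, dpi P d0 γ π s = (1 - γ) * d0 s + γ * (Pmat P π).mulVec (dpi P d0 γ π) s := by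
  have hM := aux_Pmat P hPsum π hπsum
  have hMn := aux_Pmat_nn P hPnn π hπnn
  have hsucc : ∀ t : ℕ, (Pmat P π ^ (t + 1)).mulVec d0
      = (Pmat P π).mulVec ((Pmat P π ^ t).mulVec d0) := by
    intro t
    rw [Matrix.mulVec_mulVec, pow_succ']
  have hv : ∀ t : ℕ, (∀ s, 0 ≤ (Pmat P π ^ t).mulVec d0 s) ∧
      ∑ s, (Pmat P π ^ t).mulVec d0 s = 1 := by
    intro t
    induction t with
    | zero => simpa using ⟨hd0nn, hd0sum⟩
    | succ t ih =>
      rw [hsucc]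
      exact ⟨fun s => Finset.sum_nonneg fun s' _ => mul_nonneg (hMn _ _) (ih.1 _),
        (aux_sum_mulVec _ hM _).trans ih.2⟩
  have hle : ∀ (t : ℕ) s, (Pmat P π ^ t).mulVec d0 s ≤ 1 := by
    intro t s
    rw [← (hv t).2]
    exact Finset.single_le_sum (f := fun s => (Pmat P π ^ t).mulVec d0 s)
      (fun s _ => (hv t).1 s) (Finset.mem_univ s)
  have hsum : ∀ s, Summable fun t : ℕ => γ ^ t * ((Pmat P π ^ t).mulVec d0 s) := by
    intro s
    refine Summable.of_nonneg_of_le (fun t => mul_nonneg (by positivity) ((hv t).1 s))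
      (fun t => mul_le_of_le_one_right (by positivity) (hle t s))
      (summable_geometric_of_lt_one hγ0.le hγ1)
  have hfix : ∀ s, dpi P d0 γ π s
      = (1 - γ) * d0 s + γ * (Pmat P π).mulVec (dpi P d0 γ π) s := by
    intro s
    have e : (Pmat P π).mulVec (dpi P d0 γ π) s
        = (1 - γ) * ∑' t : ℕ, γ ^ t * ((Pmat P π ^ (t + 1)).mulVec d0 s) := by
      simp only [hsucc]
      simp only [Matrix.mulVec, dotProduct, dpi, Finset.mul_sum]
      rw [Summable.tsum_finsetSum]
      · rw [Finset.mul_sum]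
        refine Finset.sum_congr rfl fun s' _ => ?_
        rw [mul_left_comm, ← tsum_mul_left]
        congr 2
        funext t
        simp only [Finset.mul_sum]
        exact Finset.sum_congr rfl fun x _ => by ring
      · intro s' _
        refine ((hsum s').mul_left (Pmat P π s s')).congr fun t => ?_
        simp only [Matrix.mulVec, dotProduct, Finset.mul_sum]
        exact Finset.sum_congr rfl fun x _ => by ring
    rw [e]
    unfold dpi
    rw [(hsum s).tsum_eq_zero_add]
    simp only [pow_zero, Matrix.one_mulVec, one_mul]
    rw [mul_add, mul_left_comm γ, ← tsum_mul_left (a := γ)]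
    congr 3
    funext t
    ring
  refine ⟨fun s => mul_nonneg (by linarith)
    (tsum_nonneg fun t => mul_nonneg (by positivity) ((hv t).1 s)), ?_, hfix⟩
  have h := Finset.sum_congr (rfl : (Finset.univ : Finset S) = Finset.univ) fun s _ => hfix s
  rw [Finset.sum_add_distrib, ← Finset.mul_sum, ← Finset.mul_sum, aux_sum_mulVec _ hM, hd0sum] at h
  have h1 : (1 - γ) * (∑ s, dpi P d0 γ π s - 1) = 0 := by linarith
  rcases mul_eq_zero.1 h1 with h2 | h2 <;> linarith

/-- KL bound on the difference of discounted state distributions: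
`‖d_π − d_π̃‖₁ ≤ (γ/(1−γ)) √(2 D_KL^{d_π}(π, π̃))`. -/
theorem kl_bound_discounted_distribution_difference
    {S A : Type*} [Fintype S] [DecidableEq S] [Fintype A]
    (P : S → A → S → ℝ) (hPnn : ∀ s a s', 0 ≤ P s a s')
    (hPsum : ∀ s a, ∑ s', P s a s' = 1)
    (d0 : S → ℝ) (hd0nn : ∀ s, 0 ≤ d0 s) (hd0sum : ∑ s, d0 s = 1)
    (γ : ℝ) (hγ0 : 0 < γ) (hγ1 : γ < 1)
    (π πt : S → A → ℝ)
    (hπnn : ∀ s a, 0 ≤ π s a) (hπsum : ∀ s, ∑ a, π s a = 1)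
    (hπtnn : ∀ s a, 0 ≤ πt s a) (hπtsum : ∀ s, ∑ a, πt s a = 1)
    (habs : ∀ s a, 0 < π s a → 0 < πt s a) :
    ∑ s, |dpi P d0 γ π s - dpi P d0 γ πt s|
      ≤ (γ / (1 - γ)) *
          Real.sqrt (2 * ∑ s, dpi P d0 γ π s *
            ∑ a, π s a * Real.log (π s a / πt s a)) := by
  obtain ⟨dn, ds, df⟩ := aux_dpi P hPnn hPsum d0 hd0nn hd0sum γ hγ0 hγ1 π hπnn hπsum
  obtain ⟨-, -, df'⟩ := aux_dpi P hPnn hPsum d0 hd0nn hd0sum γ hγ0 hγ1 πt hπtnn hπtsum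
  have hpin := aux_pinsker _ dn ds π πt hπnn hπsum hπtnn hπtsum habs
  refine le_trans ?_ (mul_le_mul_of_nonneg_left hpin (div_nonneg hγ0.le (by linarith)))
  generalize dpi P d0 γ π = d at *
  generalize dpi P d0 γ πt = d' at *
  have h1 : ∀ s, |d s - d' s| ≤
      γ * (∑ s', d s' * ∑ a, P s' a s * |π s' a - πt s' a|)
      + γ * ∑ s', Pmat P πt s s' * |d s' - d' s'| := by
    intro s
    have e : d s - d' s = γ * (∑ s', d s' * ∑ a, P s' a s * (π s' a - πt s' a))
      + γ * ∑ s', Pmat P πt s s' * (d s' - d' s') := by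
      rw [df s, df' s]
      simp only [Matrix.mulVec, dotProduct]
      have : ∀ s', ∑ a, P s' a s * (π s' a - πt s' a) = Pmat P π s s' - Pmat P πt s s' := by
        intro s'
        simp [Pmat, mul_sub]
      simp only [this]
      rw [← mul_add, ← Finset.sum_add_distrib, add_sub_add_left_eq_sub, ← mul_sub,
        ← Finset.sum_sub_distrib]
      congr 1
      exact Finset.sum_congr rfl fun s' _ => by ring
    rw [e]
    refine (abs_add_le _ _).trans (add_le_add ?_ ?_)
    · rw [abs_mul, abs_of_pos hγ0]
      refine mul_le_mul_of_nonneg_left ?_ hγ0.le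
      refine (Finset.abs_sum_le_sum_abs _ _).trans (Finset.sum_le_sum fun s' _ => ?_)
      rw [abs_mul, abs_of_nonneg (dn s')]
      refine mul_le_mul_of_nonneg_left ?_ (dn s')
      refine (Finset.abs_sum_le_sum_abs _ _).trans (Finset.sum_le_sum fun a _ => ?_)
      rw [abs_mul, abs_of_nonneg (hPnn _ _ _)]
    · rw [abs_mul, abs_of_pos hγ0]
      refine mul_le_mul_of_nonneg_left ?_ hγ0.le
      refine (Finset.abs_sum_le_sum_abs _ _).trans (Finset.sum_le_sum fun s' _ => ?_)
      rw [abs_mul, abs_of_nonneg (aux_Pmat_nn P hPnn πt hπtnn _ _)]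
  have h2 := Finset.sum_le_sum fun s (_ : s ∈ Finset.univ) => h1 s
  rw [Finset.sum_add_distrib, ← Finset.mul_sum, ← Finset.mul_sum] at h2
  have e1 : ∑ s, ∑ s', Pmat P πt s s' * |d s' - d' s'| = ∑ s, |d s - d' s| :=
    aux_sum_mulVec _ (aux_Pmat P hPsum πt hπtsum) (fun s => |d s - d' s|)
  have e2 : ∑ s, ∑ s', d s' * ∑ a, P s' a s * |π s' a - πt s' a|
      = ∑ s', d s' * ∑ a, |π s' a - πt s' a| := by
    rw [Finset.sum_comm]
    refine Finset.sum_congr rfl fun s' _ => ?_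
    rw [← Finset.mul_sum, Finset.sum_comm]
    simp [← Finset.sum_mul, hPsum]
  rw [e1, e2] at h2
  rw [div_mul_eq_mul_div, le_div_iff₀ (by linarith)]
  linarith
end
end

section
/- Recovery of the occupancy measure from its induced policy. Let μ ∈ Δ(S×A) satisfy the Bellman flow equation ∑_a μ(s',a) = (1−γ) d_0(s') + γ ∑_{s,a} P(s'|s,a) μ(s,a) for all s', and suppose ∑_b μ(s,b) > 0 for every state s. Define the induced policy π_μ(a|s) = μ(s,a)/∑_b μ(s,b). Then the discounted state-action distribution of π_μ equals μ: μ_{π_μ}(s,a) = μ(s,a) for all (s,a). -/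
open scoped BigOperators

noncomputable section

/-- The policy induced by a state-action distribution: `π_μ(a|s) = μ(s,a)/∑_b μ(s,b)`. -/
def pimu {S A : Type*} [Fintype A] (μ : S → A → ℝ) (s : S) (a : A) : ℝ :=
  μ s a / ∑ b, μ s b

/-- Recovery of the occupancy measure from its induced policy: if `μ ∈ Δ(S×A)`
satisfies the Bellman flow equation and has strictly positive state marginals, then
the occupancy measure of the induced policy `π_μ` equals `μ`. -/
theorem occupancy_recovery_from_induced_policy
    {S A : Type*} [Fintype S] [DecidableEq S] [Fintype A]
    (P : S → A → S → ℝ) (hPnn : ∀ s a s', 0 ≤ P s a s')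
    (hPsum : ∀ s a, ∑ s', P s a s' = 1)
    (d0 : S → ℝ) (hd0nn : ∀ s, 0 ≤ d0 s) (hd0sum : ∑ s, d0 s = 1)
    (γ : ℝ) (hγ0 : 0 < γ) (hγ1 : γ < 1)
    (μ : S → A → ℝ) (hμnn : ∀ s a, 0 ≤ μ s a) (hμsum : ∑ s, ∑ a, μ s a = 1)
    (hflow : ∀ s', ∑ a, μ s' a
      = (1 - γ) * d0 s' + γ * ∑ s, ∑ a, P s a s' * μ s a)
    (hpos : ∀ s, 0 < ∑ b, μ s b) :
    ∀ s a, mupi P d0 γ (pimu μ) s a = μ s a := by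
  have hMnn : ∀ s' s, 0 ≤ Pmat P (pimu μ) s' s := fun s' s =>
    Finset.sum_nonneg fun a _ => mul_nonneg (hPnn s a s') (div_nonneg (hμnn s a) (hpos s).le)
  have hMsum : ∀ s, ∑ s', Pmat P (pimu μ) s' s = 1 := by
    intro s
    unfold Pmat
    rw [Finset.sum_comm]
    simp_rw [← Finset.sum_mul, hPsum, one_mul, pimu, ← Finset.sum_div]
    exact div_self (hpos s).ne'
  have hfix : ∀ s', ∑ b, μ s' b = (1 - γ) * d0 s'
      + γ * (Pmat P (pimu μ)).mulVec (fun s => ∑ b, μ s b) s' := by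
    intro s'
    rw [hflow s']
    congr 2
    simp only [Matrix.mulVec, dotProduct, Pmat, pimu]
    refine Finset.sum_congr rfl fun s _ => ?_
    rw [Finset.sum_mul]
    refine Finset.sum_congr rfl fun a _ => ?_
    have := (hpos s).ne'
    field_simp
  have hmnn : ∀ s, 0 ≤ ∑ b, μ s b := fun s => (hpos s).le
  generalize hM : Pmat P (pimu μ) = M at *
  have hd : ∀ s, dpi P d0 γ (pimu μ) s = ∑ b, μ s b := by
    intro s
    unfold dpi
    rw [hM]
    generalize hm : (fun s => ∑ b, μ s b) = m at *
    have hms : ∀ s, ∑ b, μ s b = m s := fun s => congrFun hm s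
    simp only [hms] at *
    have hnn : ∀ v : S → ℝ, (∀ s, 0 ≤ v s) → ∀ (t : ℕ) s, 0 ≤ (M ^ t).mulVec v s := by
      intro v hv t
      induction t with
      | zero => simpa using hv
      | succ t ih =>
        intro s
        rw [pow_succ', ← Matrix.mulVec_mulVec]
        exact Finset.sum_nonneg fun i _ => mul_nonneg (hMnn s i) (ih i)
    have hsum : ∀ t : ℕ, ∑ s, (M ^ t).mulVec m s = 1 := by
      intro t
      induction t with
      | zero => simpa using hμsum
      | succ t ih =>
        rw [pow_succ', ← Matrix.mulVec_mulVec, ← ih]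
        generalize (M ^ t).mulVec m = v
        simp only [Matrix.mulVec, dotProduct]
        rw [Finset.sum_comm]
        simp_rw [← Finset.sum_mul, hMsum, one_mul]
    have hle : ∀ t : ℕ, (M ^ t).mulVec m s ≤ 1 := fun t => by
      rw [← hsum t]
      exact Finset.single_le_sum (fun i _ => hnn m hmnn t i) (Finset.mem_univ s)
    have hfix' : m = (1 - γ) • d0 + γ • M.mulVec m := by
      funext s
      simpa using hfix s
    have hstep : ∀ n : ℕ, (M ^ n).mulVec m s
        = (1 - γ) * (M ^ n).mulVec d0 s + γ * (M ^ (n + 1)).mulVec m s := by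
      intro n
      conv_lhs => rw [hfix']
      rw [Matrix.mulVec_add, Matrix.mulVec_smul, Matrix.mulVec_smul, Matrix.mulVec_mulVec,
        ← pow_succ]
      simp
    have hpart : ∀ n : ℕ, ∑ t ∈ Finset.range n, (1 - γ) * (γ ^ t * (M ^ t).mulVec d0 s)
        = m s - γ ^ n * (M ^ n).mulVec m s := by
      intro n
      induction n with
      | zero => simp
      | succ n ih =>
        rw [Finset.sum_range_succ, ih, hstep n]
        ring
    have hlim : Filter.Tendsto (fun n : ℕ => γ ^ n * (M ^ n).mulVec m s) Filter.atTop
        (nhds 0) := by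
      refine squeeze_zero (fun n => mul_nonneg (pow_nonneg hγ0.le n) (hnn m hmnn n s))
        (fun n => mul_le_of_le_one_right (pow_nonneg hγ0.le n) (hle n))
        (tendsto_pow_atTop_nhds_zero_of_lt_one hγ0.le hγ1)
    have hS : HasSum (fun t : ℕ => (1 - γ) * (γ ^ t * (M ^ t).mulVec d0 s)) (m s) := by
      rw [hasSum_iff_tendsto_nat_of_nonneg]
      · simp_rw [hpart]
        simpa using hlim.const_sub (m s)
      · exact fun t => mul_nonneg (by linarith)
          (mul_nonneg (pow_nonneg hγ0.le t) (hnn d0 hd0nn t s))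
    rw [← tsum_mul_left, hS.tsum_eq]
  intro s a
  rw [mupi, hd, pimu]
  exact mul_div_cancel₀ _ (hpos s).ne'
end
end
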